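/- Let a, b be coprime positive integers and p a non-negative integer. The largest integer n such that the equation ax + by = n has at most p solutions in non-negative integers (x,y) equals (p+1)ab - a - b. -/

import Mathlib

/-- number of representations of the integer `n` as `a*x+b*y` with `x y : ℕ`. -/
noncomputable def numRep2 (a b : ℕ) (n : ℤ) : ℕ :=
  Set.ncard {xy : ℕ × ℕ | (a : ℤ) * xy.1 + (b : ℤ) * xy.2 = n}

theorem stmt_2 (a b p : ℕ) (ha : 0 < a) (hb : 0 < b) (hab : Nat.Coprime a b) :
    IsGreatest {n : ℤ | numRep2 a b n ≤ p}
      (((p : ℤ) + 1) * a * b - a - b) := by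
  have haZ : (0 : ℤ) < a := by exact_mod_cast ha
  have hbZ : (0 : ℤ) < b := by exact_mod_cast hb
  have hco : IsCoprime (a : ℤ) (b : ℤ) := Nat.isCoprime_iff_coprime.mpr hab
  constructor
  · show Set.ncard _ ≤ p
    have hsub : {xy : ℕ × ℕ | (a : ℤ) * xy.1 + (b : ℤ) * xy.2 = ((p : ℤ) + 1) * a * b - a - b} ⊆
        (((Finset.range p).image (fun k => (b * (k + 1) - 1, a * (p - k) - 1)) :
          Finset (ℕ × ℕ)) : Set (ℕ × ℕ)) := by
      rintro ⟨x, y⟩ h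
      simp only [Set.mem_setOf_eq] at h
      have hd : (b : ℤ) ∣ (x : ℤ) + 1 := by
        apply hco.symm.dvd_of_dvd_mul_left
        exact ⟨((p : ℤ) + 1) * a - y - 1, by linear_combination h⟩
      obtain ⟨k, hk⟩ := hd
      have hy : (y : ℤ) + 1 = a * (p + 1 - k) := by
        apply mul_left_cancel₀ hbZ.ne'
        linear_combination h - a * hk
      have hk0 : 0 < k := by
        by_contra hc
        nlinarith
      have hk1 : 0 < (p : ℤ) + 1 - k := by
        by_contra hc
        nlinarith
      obtain ⟨j, rfl⟩ : ∃ j : ℕ, k = j + 1 := ⟨(k - 1).toNat, by omega⟩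
      have hjp : j < p := by omega
      simp only [Finset.coe_image, Set.mem_image, Finset.coe_range, Set.mem_Iio]
      refine ⟨j, hjp, ?_⟩
      have h1 : x + 1 = b * (j + 1) := by exact_mod_cast hk
      have h2 : y + 1 = a * (p - j) := by
        zify [hjp.le]
        rw [hy]; ring
      ext <;> simp <;> omega
    refine (Set.ncard_le_ncard hsub (Finset.finite_toSet _)).trans ?_
    rw [Set.ncard_coe_finset]
    exact Finset.card_image_le.trans (by simp)
  · intro n hn
    by_contra! hlt
    have hn' : Set.ncard {xy : ℕ × ℕ | (a : ℤ) * xy.1 + (b : ℤ) * xy.2 = n} ≤ p := hn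
    have hfin : {xy : ℕ × ℕ | (a : ℤ) * xy.1 + (b : ℤ) * xy.2 = n}.Finite := by
      refine Set.Finite.subset (Finset.finite_toSet
        (Finset.range (n.toNat + 1) ×ˢ Finset.range (n.toNat + 1))) ?_
      rintro ⟨x, y⟩ h
      simp only [Set.mem_setOf_eq] at h
      have h1 : (x : ℤ) ≤ n := by nlinarith
      have h2 : (y : ℤ) ≤ n := by nlinarith
      simp only [Finset.coe_product, Finset.coe_range, Set.mem_prod, Set.mem_Iio]
      omega
    obtain ⟨u, v, huv⟩ := hco
    have hx0 := Int.emod_nonneg (n * u) hbZ.ne'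
    have hx1 := Int.emod_lt_of_pos (n * u) hbZ
    have hx2 := Int.emod_add_mul_ediv (n * u) b
    obtain ⟨x, hx⟩ := Int.eq_ofNat_of_zero_le hx0
    rw [hx] at hx1 hx2
    obtain ⟨y, hy⟩ : ∃ y : ℤ, a * (x : ℤ) + b * y = n :=
      ⟨n * v + a * (n * u / b), by linear_combination n * huv + a * hx2⟩
    have hyp : (p : ℤ) * a ≤ y := by
      have : (b : ℤ) * (p * a - 1) < b * y := by nlinarith
      have := lt_of_mul_lt_mul_left this hbZ.le
      omega
    have hsub : (((Finset.range (p + 1)).image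
        (fun k : ℕ => (x + k * b, (y - k * a).toNat)) : Finset (ℕ × ℕ)) : Set (ℕ × ℕ)) ⊆
        {xy : ℕ × ℕ | (a : ℤ) * xy.1 + (b : ℤ) * xy.2 = n} := by
      intro q hq
      simp only [Finset.coe_image, Set.mem_image, Finset.coe_range, Set.mem_Iio] at hq
      obtain ⟨k, hk, rfl⟩ := hq
      have hkp : (k : ℤ) ≤ p := by omega
      have h0 : 0 ≤ y - k * a := by nlinarith
      simp only [Set.mem_setOf_eq, Int.toNat_of_nonneg h0]
      push_cast
      linear_combination hy
    have hc := Set.ncard_le_ncard hsub hfin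
    rw [Set.ncard_coe_finset, Finset.card_image_of_injective, Finset.card_range] at hc
    · omega
    · intro k l hkl
      simp only [Prod.mk.injEq] at hkl
      exact Nat.eq_of_mul_eq_mul_right hb (by omega)
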